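/- Let U ⊆ ℝ⁴ \ {0} be an open conic set and L : U → ℝ a smooth, nowhere-zero function, positively homogeneous of degree 2, whose L-metric g(y) (entries g_{ij}(y) = (1/2)∂²L/∂yⁱ∂yʲ(y)) is invertible on U with inverse entries g^{ij}(y). Let φ be a constant symmetric real 4×4 matrix and write φ(y,y) = Σ φ_{mn}y^m y^n. Define X^j(y) := L(y)·Σ_k g^{jk}(y)·∂/∂y^k [ φ(y,y)/(2L(y)) ]. Then for every y ∈ U: ( Σ_{i,j} g^{ij}(y)φ_{ij} − 4 φ(y,y)/L(y) ) · det g(y)/L(y)² = Σ_j ∂/∂yʲ [ X^j · det g/L² ](y). -/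

import Mathlib

noncomputable section

/-- Partial derivative `∂f/∂yⁱ(y)`. -/
def pd (f : (Fin 4 → ℝ) → ℝ) (i : Fin 4) (y : Fin 4 → ℝ) : ℝ :=
  fderiv ℝ f y (Pi.single i 1)

/-- The L-metric: the matrix `g_{ij}(y) = (1/2) ∂²L/∂yⁱ∂yʲ (y)`. -/
def Lmetric (L : (Fin 4 → ℝ) → ℝ) (y : Fin 4 → ℝ) : Matrix (Fin 4) (Fin 4) ℝ :=
  Matrix.of fun i j => (1 / 2) * pd (pd L j) i y

/-- The quadratic form `φ(y,y) = Σ φ_{mn} y^m y^n` of a constant 4×4 matrix. -/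
def quadForm (φ : Matrix (Fin 4) (Fin 4) ℝ) (y : Fin 4 → ℝ) : ℝ :=
  ∑ m, ∑ n, φ m n * y m * y n

/-- The boundary vector field `X^j(y) = L(y) Σ_k g^{jk}(y) ∂_k[φ(y,y)/(2L(y))]`. -/
def bdryField (L : (Fin 4 → ℝ) → ℝ) (φ : Matrix (Fin 4) (Fin 4) ℝ) (j : Fin 4)
    (y : Fin 4 → ℝ) : ℝ :=
  L y * ∑ k, (Lmetric L y)⁻¹ j k * pd (fun z => quadForm φ z / (2 * L z)) k y

open scoped ContDiff

lemma pd_congr {U : Set (Fin 4 → ℝ)} (hU : IsOpen U) {f h : (Fin 4 → ℝ) → ℝ}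
    (hfh : ∀ y ∈ U, f y = h y) (i : Fin 4) {y : Fin 4 → ℝ} (hy : y ∈ U) :
    pd f i y = pd h i y := by
  unfold pd
  have : f =ᶠ[nhds y] h := by
    filter_upwards [hU.mem_nhds hy] with z hz using hfh z hz
  rw [this.fderiv_eq]

lemma pd_mul {f h : (Fin 4 → ℝ) → ℝ} {y : Fin 4 → ℝ} (hf : DifferentiableAt ℝ f y)
    (hh : DifferentiableAt ℝ h y) (i : Fin 4) :
    pd (fun z => f z * h z) i y = pd f i y * h y + f y * pd h i y := by
  unfold pd
  rw [fderiv_fun_mul hf hh]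
  simp
  ring

lemma pd_sub {f h : (Fin 4 → ℝ) → ℝ} {y : Fin 4 → ℝ} (hf : DifferentiableAt ℝ f y)
    (hh : DifferentiableAt ℝ h y) (i : Fin 4) :
    pd (fun z => f z - h z) i y = pd f i y - pd h i y := by
  unfold pd
  rw [fderiv_fun_sub hf hh]
  simp

lemma pd_sum {f : Fin 4 → (Fin 4 → ℝ) → ℝ} {y : Fin 4 → ℝ}
    (hf : ∀ k, DifferentiableAt ℝ (f k) y) (i : Fin 4) :
    pd (fun z => ∑ k, f k z) i y = ∑ k, pd (f k) i y := by
  unfold pd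
  rw [fderiv_fun_sum (fun k _ => hf k)]
  simp

lemma pd_const (c : ℝ) (i : Fin 4) (y : Fin 4 → ℝ) : pd (fun _ => c) i y = 0 := by
  unfold pd; simp

lemma pd_const_mul {f : (Fin 4 → ℝ) → ℝ} {y : Fin 4 → ℝ} (c : ℝ) (hf : DifferentiableAt ℝ f y)
    (i : Fin 4) : pd (fun z => c * f z) i y = c * pd f i y := by
  rw [pd_mul (by fun_prop) hf, pd_const]; ring

lemma pd_coord (k i : Fin 4) (y : Fin 4 → ℝ) :
    pd (fun z => z k) i y = if k = i then 1 else 0 := by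
  unfold pd
  rw [(hasFDerivAt_apply k y).fderiv]
  simp [Pi.single_apply]

lemma pd_inv {f : (Fin 4 → ℝ) → ℝ} {y : Fin 4 → ℝ} (hf : DifferentiableAt ℝ f y)
    (h0 : f y ≠ 0) (i : Fin 4) :
    pd (fun z => (f z)⁻¹) i y = - pd f i y * (f y)⁻¹ ^ 2 := by
  unfold pd
  have := (hasDerivAt_inv h0).comp_hasFDerivAt y hf.hasFDerivAt
  have h2 : fderiv ℝ (fun z => (f z)⁻¹) y = _ := this.fderiv
  rw [h2]
  simp
  ring

lemma pd_smooth {U : Set (Fin 4 → ℝ)} (hU : IsOpen U) {f : (Fin 4 → ℝ) → ℝ}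
    (hf : ContDiffOn ℝ ∞ f U) (i : Fin 4) : ContDiffOn ℝ ∞ (pd f i) U := by
  have := ((contDiffOn_infty_iff_fderiv_of_isOpen hU).1 hf).2
  exact this.clm_apply contDiffOn_const

lemma diffAt {U : Set (Fin 4 → ℝ)} (hU : IsOpen U) {f : (Fin 4 → ℝ) → ℝ}
    (hf : ContDiffOn ℝ ∞ f U) {y : Fin 4 → ℝ} (hy : y ∈ U) : DifferentiableAt ℝ f y :=
  (hf.contDiffAt (hU.mem_nhds hy)).differentiableAt (by simp)

lemma pd_symm {U : Set (Fin 4 → ℝ)} (hU : IsOpen U) {f : (Fin 4 → ℝ) → ℝ}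
    (hf : ContDiffOn ℝ ∞ f U) {y : Fin 4 → ℝ} (hy : y ∈ U) (i j : Fin 4) :
    pd (pd f i) j y = pd (pd f j) i y := by
  have hc := hf.contDiffAt (hU.mem_nhds hy)
  have hs : IsSymmSndFDerivAt ℝ f y := hc.isSymmSndFDerivAt (by simp; exact WithTop.coe_le_coe.2 (le_top (a := (2 : ℕ∞))))
  have hd : DifferentiableAt ℝ (fderiv ℝ f) y :=
    ((((contDiffOn_infty_iff_fderiv_of_isOpen hU).1 hf).2).contDiffAt
      (hU.mem_nhds hy)).differentiableAt (by simp)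
  have key : ∀ a b : Fin 4, pd (pd f a) b y
      = fderiv ℝ (fderiv ℝ f) y (Pi.single b 1) (Pi.single a 1) := by
    intro a b
    change fderiv ℝ (fun z => fderiv ℝ f z (Pi.single a 1)) y (Pi.single b 1) = _
    rw [fderiv_clm_apply hd (by fun_prop)]
    simp
  rw [key, key, hs.eq]

/-- Determinant as a continuous multilinear map of the rows. -/
def detCM : ContinuousMultilinearMap ℝ (fun _ : Fin 4 => (Fin 4 → ℝ)) ℝ :=
  { (Matrix.detRowAlternating (n := Fin 4) (R := ℝ)).toMultilinearMap with
    cont := by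
      change Continuous (fun A : Matrix (Fin 4) (Fin 4) ℝ => A.det)
      fun_prop }

lemma detCM_apply (A : Matrix (Fin 4) (Fin 4) ℝ) : detCM (fun i => A i) = A.det := rfl

lemma det_updateRow_eq (A : Matrix (Fin 4) (Fin 4) ℝ) (i : Fin 4) (v : Fin 4 → ℝ) :
    (A.updateRow i v).det = ∑ j, A.adjugate j i * v j := by
  rw [Matrix.det_eq_sum_mul_adjugate_row _ i]
  refine Finset.sum_congr rfl fun j _ => ?_
  rw [Matrix.adjugate_apply, Matrix.adjugate_apply]
  simp
  ring

lemma pd_det {G : (Fin 4 → ℝ) → Matrix (Fin 4) (Fin 4) ℝ} {y : Fin 4 → ℝ}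
    (hG : ∀ i j, DifferentiableAt ℝ (fun z => G z i j) y) (l : Fin 4) :
    pd (fun z => (G z).det) l y
      = ∑ i, ∑ j, (G y).adjugate j i * pd (fun z => G z i j) l y := by
  have hrow : ∀ i, HasFDerivAt (fun z => (G z i : Fin 4 → ℝ))
      (ContinuousLinearMap.pi fun j => fderiv ℝ (fun z => G z i j) y) y := fun i =>
    hasFDerivAt_pi.2 fun j => (hG i j).hasFDerivAt
  have h := HasFDerivAt.multilinear_comp (f := detCM) hrow
  have h2 : fderiv ℝ (fun z => (G z).det) y = _ := h.fderiv
  unfold pd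
  rw [h2]
  simp only [_root_.sum_apply]
  refine Finset.sum_congr rfl fun i _ => ?_
  rw [← det_updateRow_eq]
  rfl

lemma euler {U : Set (Fin 4 → ℝ)} (hU : IsOpen U)
    {L : (Fin 4 → ℝ) → ℝ} (hLs : ContDiffOn ℝ ∞ L U)
    (hhom : ∀ y ∈ U, ∀ l : ℝ, 0 < l → L (l • y) = l ^ 2 * L y) {y : Fin 4 → ℝ} (hy : y ∈ U) :
    ∑ j, pd L j y * y j = 2 * L y := by
  have hd := (diffAt hU hLs hy).hasFDerivAt
  have h1 : HasDerivAt (fun t : ℝ => t • y) y 1 := by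
    simpa using (hasDerivAt_id (1:ℝ)).smul_const y
  have h2 : HasDerivAt (fun t : ℝ => L (t • y)) (fderiv ℝ L y y) 1 := by
    refine HasFDerivAt.comp_hasDerivAt (f := fun t : ℝ => t • y) 1 ?_ h1
    simpa using hd
  have h3 : HasDerivAt (fun t : ℝ => t ^ 2 * L y) (2 * L y) 1 := by
    simpa using (hasDerivAt_pow 2 (1:ℝ)).mul_const (L y)
  have h4 : (fun t : ℝ => L (t • y)) =ᶠ[nhds 1] fun t : ℝ => t ^ 2 * L y := by
    filter_upwards [lt_mem_nhds (zero_lt_one (α := ℝ))] with t ht using hhom y hy t ht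
  have h5 := (h3.congr_of_eventuallyEq h4).unique h2
  rw [h5]
  conv_rhs => rw [← Finset.univ_sum_single y]
  have hy' : ∑ i, Pi.single i (y i) = ∑ i, (y i) • (Pi.single i 1 : Fin 4 → ℝ) := by
    refine Finset.sum_congr rfl fun i _ => ?_
    rw [← Pi.single_smul]; simp
  rw [Finset.univ_sum_single y] 
  rw [show fderiv ℝ L y y = fderiv ℝ L y (∑ i, (y i) • (Pi.single i 1 : Fin 4 → ℝ)) by
    rw [← hy', Finset.univ_sum_single]]
  rw [map_sum]
  refine Finset.sum_congr rfl fun i _ => ?_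
  rw [map_smul]
  unfold pd
  simp [mul_comm]

lemma diff_det {G : (Fin 4 → ℝ) → Matrix (Fin 4) (Fin 4) ℝ} {y : Fin 4 → ℝ}
    (hG : ∀ i j, DifferentiableAt ℝ (fun z => G z i j) y) :
    DifferentiableAt ℝ (fun z => (G z).det) y := by
  have hrow : ∀ i, HasFDerivAt (fun z => (G z i : Fin 4 → ℝ))
      (ContinuousLinearMap.pi fun j => fderiv ℝ (fun z => G z i j) y) y := fun i =>
    hasFDerivAt_pi.2 fun j => (hG i j).hasFDerivAt
  exact (HasFDerivAt.multilinear_comp (f := detCM) hrow).differentiableAt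

lemma diff_adj {G : (Fin 4 → ℝ) → Matrix (Fin 4) (Fin 4) ℝ} {y : Fin 4 → ℝ}
    (hG : ∀ i j, DifferentiableAt ℝ (fun z => G z i j) y) (j k : Fin 4) :
    DifferentiableAt ℝ (fun z => (G z).adjugate j k) y := by
  simp only [Matrix.adjugate_apply]
  refine diff_det fun a b => ?_
  simp only [Matrix.updateRow_apply]
  split_ifs
  · fun_prop
  · exact hG a b

lemma g_diff {U : Set (Fin 4 → ℝ)} (hU : IsOpen U)
    {L : (Fin 4 → ℝ) → ℝ} (hLs : ContDiffOn ℝ ∞ L U)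
    {y : Fin 4 → ℝ} (hy : y ∈ U) (i j : Fin 4) :
    DifferentiableAt ℝ (fun z => Lmetric L z i j) y := by
  have := diffAt hU (pd_smooth hU (pd_smooth hU hLs j) i) hy
  simp only [Lmetric, Matrix.of_apply]
  exact this.const_mul _

lemma g_symm {U : Set (Fin 4 → ℝ)} (hU : IsOpen U)
    {L : (Fin 4 → ℝ) → ℝ} (hLs : ContDiffOn ℝ ∞ L U)
    {y : Fin 4 → ℝ} (hy : y ∈ U) (i j : Fin 4) :
    Lmetric L y i j = Lmetric L y j i := by
  simp only [Lmetric, Matrix.of_apply]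
  rw [pd_symm hU hLs hy]

lemma T_symm1 {U : Set (Fin 4 → ℝ)} (hU : IsOpen U)
    {L : (Fin 4 → ℝ) → ℝ} (hLs : ContDiffOn ℝ ∞ L U)
    {y : Fin 4 → ℝ} (hy : y ∈ U) (l i j : Fin 4) :
    pd (fun z => Lmetric L z i j) l y = pd (fun z => Lmetric L z j i) l y :=
  pd_congr hU (fun z hz => g_symm hU hLs hz i j) l hy

lemma T_symm2 {U : Set (Fin 4 → ℝ)} (hU : IsOpen U)
    {L : (Fin 4 → ℝ) → ℝ} (hLs : ContDiffOn ℝ ∞ L U)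
    {y : Fin 4 → ℝ} (hy : y ∈ U) (l i j : Fin 4) :
    pd (fun z => Lmetric L z i j) l y = pd (fun z => Lmetric L z l j) i y := by
  have hh := pd_smooth hU hLs j
  simp only [Lmetric, Matrix.of_apply]
  rw [pd_const_mul _ (diffAt hU (pd_smooth hU hh i) hy),
    pd_const_mul _ (diffAt hU (pd_smooth hU hh l) hy), pd_symm hU hh hy]

lemma piola {U : Set (Fin 4 → ℝ)} (hU : IsOpen U)
    {L : (Fin 4 → ℝ) → ℝ} (hLs : ContDiffOn ℝ ∞ L U)
    {y : Fin 4 → ℝ} (hy : y ∈ U) (hinv : IsUnit (Lmetric L y).det) (k : Fin 4) :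
    ∑ j, pd (fun z => (Lmetric L z).adjugate j k) j y = 0 := by
  have hG := g_diff hU hLs hy
  have hA := diff_adj (G := Lmetric L) hG
  set V : Fin 4 → ℝ := fun k => ∑ j, pd (fun z => (Lmetric L z).adjugate j k) j y with hV
  have hVg : Matrix.vecMul V (Lmetric L y) = 0 := by
    funext l
    have h1 : ∀ j, pd (fun z => ∑ k, (Lmetric L z).adjugate j k * Lmetric L z k l) j y
        = pd (fun z => (if j = l then 1 else 0) * (Lmetric L z).det) j y := by
      intro j
      congr 1
      funext z
      have := congrFun (congrFun (Matrix.adjugate_mul (Lmetric L z)) j) l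
      rw [Matrix.mul_apply] at this
      rw [this]
      simp [Matrix.one_apply]
    have h2 : ∀ j, pd (fun z => ∑ k, (Lmetric L z).adjugate j k * Lmetric L z k l) j y
        = ∑ k, (pd (fun z => (Lmetric L z).adjugate j k) j y * Lmetric L y k l
          + (Lmetric L y).adjugate j k * pd (fun z => Lmetric L z k l) j y) := by
      intro j
      rw [pd_sum (fun k => (hA j k).fun_mul (hG k l))]
      exact Finset.sum_congr rfl fun k _ => pd_mul (hA j k) (hG k l) j
    have h3 : ∑ j, pd (fun z => (if j = l then 1 else 0) * (Lmetric L z).det) j y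
        = ∑ i, ∑ j, (Lmetric L y).adjugate j i * pd (fun z => Lmetric L z i j) l y := by
      rw [← pd_det hG]
      simp_rw [pd_const_mul _ (diff_det hG)]
      simp
    have h4 : ∑ i, ∑ j, (Lmetric L y).adjugate j i * pd (fun z => Lmetric L z i j) l y
        = ∑ j, ∑ k, (Lmetric L y).adjugate j k * pd (fun z => Lmetric L z k l) j y := by
      rw [Finset.sum_comm]
      refine Finset.sum_congr rfl fun j _ => Finset.sum_congr rfl fun k _ => ?_
      rw [T_symm1 hU hLs hy l k j, T_symm2 hU hLs hy l j k, T_symm1 hU hLs hy j l k]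
    rw [← Finset.sum_congr rfl (fun j _ => h1 j), Finset.sum_congr rfl (fun j _ => h2 j), h4] at h3
    simp only [Finset.sum_add_distrib] at h3
    have h5 := left_eq_add.1 (h3.symm.trans (add_comm _ _))
    simp only [Matrix.vecMul, dotProduct, hV, Finset.sum_mul, Pi.zero_apply]
    rw [Finset.sum_comm]
    exact h5
  have := congrArg (fun v => Matrix.vecMul v (Lmetric L y)⁻¹) hVg
  simp only [Matrix.vecMul_vecMul, Matrix.mul_nonsing_inv _ hinv, Matrix.vecMul_one,
    Matrix.zero_vecMul] at this
  exact congrFun this k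

lemma euler2 {U : Set (Fin 4 → ℝ)} (hU : IsOpen U)
    {L : (Fin 4 → ℝ) → ℝ} (hLs : ContDiffOn ℝ ∞ L U)
    (hhom : ∀ y ∈ U, ∀ l : ℝ, 0 < l → L (l • y) = l ^ 2 * L y)
    {y : Fin 4 → ℝ} (hy : y ∈ U) (i : Fin 4) :
    ∑ j, Lmetric L y i j * y j = 1 / 2 * pd L i y := by
  have hd := fun j => diffAt hU (pd_smooth hU hLs j) hy
  have h := pd_congr hU (fun z hz => euler hU hLs hhom hz) i hy
  rw [pd_const_mul _ (diffAt hU hLs hy), pd_sum (fun j => (hd j).fun_mul (by fun_prop))] at h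
  simp_rw [fun j => pd_mul (h := fun z => z j) (hd j) (by fun_prop) i, pd_coord] at h
  simp [Finset.sum_add_distrib] at h
  simp only [Lmetric, Matrix.of_apply, mul_assoc]
  rw [← Finset.mul_sum]
  linarith

lemma euler3 {U : Set (Fin 4 → ℝ)} (hU : IsOpen U)
    {L : (Fin 4 → ℝ) → ℝ} (hLs : ContDiffOn ℝ ∞ L U)
    (hhom : ∀ y ∈ U, ∀ l : ℝ, 0 < l → L (l • y) = l ^ 2 * L y)
    {y : Fin 4 → ℝ} (hy : y ∈ U) (l i : Fin 4) :
    ∑ j, pd (fun z => Lmetric L z i j) l y * y j = 0 := by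
  have hG := g_diff hU hLs hy
  have h := pd_congr hU (fun z hz => euler2 hU hLs hhom hz i) l hy
  rw [pd_const_mul _ (diffAt hU (pd_smooth hU hLs i) hy),
    pd_sum (fun j => (hG i j).fun_mul (by fun_prop))] at h
  simp_rw [fun j => pd_mul (h := fun z => z j) (hG i j) (by fun_prop) l, pd_coord] at h
  have h2 : Lmetric L y i l = 1 / 2 * pd (pd L i) l y := by
    rw [g_symm hU hLs hy]; rfl
  simp [Finset.sum_add_distrib] at h
  linarith

lemma euler_det {U : Set (Fin 4 → ℝ)} (hU : IsOpen U)
    {L : (Fin 4 → ℝ) → ℝ} (hLs : ContDiffOn ℝ ∞ L U)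
    (hhom : ∀ y ∈ U, ∀ l : ℝ, 0 < l → L (l • y) = l ^ 2 * L y)
    {y : Fin 4 → ℝ} (hy : y ∈ U) :
    ∑ l, pd (fun z => (Lmetric L z).det) l y * y l = 0 := by
  have hG := g_diff hU hLs hy
  simp_rw [pd_det hG, Finset.sum_mul]
  rw [Finset.sum_comm]
  refine Finset.sum_eq_zero fun i _ => ?_
  rw [Finset.sum_comm]
  refine Finset.sum_eq_zero fun j _ => ?_
  have := euler3 hU hLs hhom hy i j
  simp_rw [mul_assoc, ← Finset.mul_sum]
  simp_rw [fun l => T_symm2 hU hLs hy l i j]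
  simp_rw [fun l => T_symm1 hU hLs hy i l j]
  rw [this, mul_zero]

lemma adj_dL {U : Set (Fin 4 → ℝ)} (hU : IsOpen U)
    {L : (Fin 4 → ℝ) → ℝ} (hLs : ContDiffOn ℝ ∞ L U)
    (hhom : ∀ y ∈ U, ∀ l : ℝ, 0 < l → L (l • y) = l ^ 2 * L y)
    {y : Fin 4 → ℝ} (hy : y ∈ U) (j : Fin 4) :
    ∑ k, (Lmetric L y).adjugate j k * pd L k y = 2 * (Lmetric L y).det * y j := by
  have h1 : (pd L · y) = (2 : ℝ) • (Lmetric L y).mulVec y := by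
    funext k
    simp only [Pi.smul_apply, Matrix.mulVec, dotProduct, smul_eq_mul]
    rw [euler2 hU hLs hhom hy]; ring
  have h2 : (Lmetric L y).adjugate.mulVec (pd L · y) = (2 * (Lmetric L y).det) • y := by
    rw [h1, Matrix.mulVec_smul, Matrix.mulVec_mulVec, Matrix.adjugate_mul, Matrix.smul_mulVec,
      Matrix.one_mulVec, smul_smul]
  have := congrFun h2 j
  simpa [Matrix.mulVec, dotProduct] using this

lemma adj_dL' {U : Set (Fin 4 → ℝ)} (hU : IsOpen U)
    {L : (Fin 4 → ℝ) → ℝ} (hLs : ContDiffOn ℝ ∞ L U)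
    (hhom : ∀ y ∈ U, ∀ l : ℝ, 0 < l → L (l • y) = l ^ 2 * L y)
    {y : Fin 4 → ℝ} (hy : y ∈ U) (k : Fin 4) :
    ∑ j, (Lmetric L y).adjugate j k * pd L j y = 2 * (Lmetric L y).det * y k := by
  have hs : (Lmetric L y).transpose = Lmetric L y := by
    ext i j; exact g_symm hU hLs hy j i
  have : ∀ j, (Lmetric L y).adjugate j k = (Lmetric L y).adjugate k j := by
    intro j
    conv_lhs => rw [← hs, ← Matrix.adjugate_transpose]
    rfl
  simp_rw [this]
  exact adj_dL hU hLs hhom hy k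

lemma quad_diff (φ : Matrix (Fin 4) (Fin 4) ℝ) (y : Fin 4 → ℝ) :
    DifferentiableAt ℝ (quadForm φ) y := by
  unfold quadForm
  fun_prop

/-- `w_k = φ_{km} y^m`. -/
def wvec (φ : Matrix (Fin 4) (Fin 4) ℝ) (k : Fin 4) (y : Fin 4 → ℝ) : ℝ := ∑ m, φ k m * y m

lemma w_diff (φ : Matrix (Fin 4) (Fin 4) ℝ) (k : Fin 4) (y : Fin 4 → ℝ) :
    DifferentiableAt ℝ (wvec φ k) y := by
  unfold wvec
  fun_prop

lemma pd_w (φ : Matrix (Fin 4) (Fin 4) ℝ) (k i : Fin 4) (y : Fin 4 → ℝ) :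
    pd (wvec φ k) i y = φ k i := by
  unfold wvec
  rw [pd_sum (fun m => by fun_prop)]
  simp_rw [fun m => pd_const_mul (f := fun z => z m) (y := y) (φ k m) (by fun_prop) i, pd_coord]
  simp

lemma quad_eq (φ : Matrix (Fin 4) (Fin 4) ℝ) : quadForm φ = fun y => ∑ k, y k * wvec φ k y := by
  funext y
  simp only [quadForm, wvec, Finset.mul_sum]
  exact Finset.sum_congr rfl fun m _ => Finset.sum_congr rfl fun n _ => by ring

lemma pd_quad {φ : Matrix (Fin 4) (Fin 4) ℝ} (hφ : φ.IsSymm) (i : Fin 4) (y : Fin 4 → ℝ) :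
    pd (quadForm φ) i y = 2 * wvec φ i y := by
  rw [quad_eq]
  have hw := fun k => w_diff φ k y
  rw [pd_sum (fun m => by have := hw m; fun_prop)]
  simp_rw [fun m => pd_mul (f := fun z => z m) (y := y) (by fun_prop) (hw m) i, pd_coord, pd_w]
  have : ∑ m, y m * φ m i = wvec φ i y := by
    unfold wvec
    exact Finset.sum_congr rfl fun m _ => by rw [hφ.apply]; ring
  simp [Finset.sum_add_distrib, this]
  ring

lemma bdry_eq {U : Set (Fin 4 → ℝ)} (hU : IsOpen U)
    {L : (Fin 4 → ℝ) → ℝ} (hLs : ContDiffOn ℝ ∞ L U) (hL0 : ∀ y ∈ U, L y ≠ 0)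
    (hhom : ∀ y ∈ U, ∀ l : ℝ, 0 < l → L (l • y) = l ^ 2 * L y)
    (hinv : ∀ y ∈ U, IsUnit (Lmetric L y).det)
    {φ : Matrix (Fin 4) (Fin 4) ℝ} (hφ : φ.IsSymm) (j : Fin 4) {y : Fin 4 → ℝ} (hy : y ∈ U) :
    bdryField L φ j y * (Lmetric L y).det / (L y) ^ 2 =
      (∑ k, (Lmetric L y).adjugate j k * wvec φ k y) * ((L y)⁻¹ * (L y)⁻¹)
        - quadForm φ y * y j * (Lmetric L y).det * ((L y)⁻¹ * (L y)⁻¹ * (L y)⁻¹) := by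
  have hL := hL0 y hy
  have hD : (Lmetric L y).det ≠ 0 := (hinv y hy).ne_zero
  have hdL := diffAt hU hLs hy
  have h1 : ∀ k, pd (fun z => quadForm φ z / (2 * L z)) k y
      = wvec φ k y * (L y)⁻¹ - 1 / 2 * quadForm φ y * pd L k y * (L y)⁻¹ ^ 2 := by
    intro k
    have e : (fun z => quadForm φ z / (2 * L z)) = fun z => 1 / 2 * (quadForm φ z * (L z)⁻¹) := by
      funext z
      rw [div_eq_mul_inv, mul_inv]; ring
    have hi : DifferentiableAt ℝ (fun z => (L z)⁻¹) y := hdL.fun_inv hL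
    rw [e, pd_const_mul _ ((quad_diff φ y).fun_mul hi), pd_mul (quad_diff φ y) hi,
      pd_inv hdL hL, pd_quad hφ]
    ring
  have h2 : ∀ k, (Lmetric L y)⁻¹ j k = ((Lmetric L y).det)⁻¹ * (Lmetric L y).adjugate j k := by
    intro k
    rw [Matrix.inv_def, Ring.inverse_eq_inv']
    rfl
  have h3 := adj_dL hU hLs hhom hy j
  unfold bdryField
  simp_rw [h1, h2]
  have h4 : ∑ k, ((Lmetric L y).det)⁻¹ * (Lmetric L y).adjugate j k *
        (wvec φ k y * (L y)⁻¹ - 1 / 2 * quadForm φ y * pd L k y * (L y)⁻¹ ^ 2)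
      = ((Lmetric L y).det)⁻¹ * (L y)⁻¹ * (∑ k, (Lmetric L y).adjugate j k * wvec φ k y)
        - 1 / 2 * ((Lmetric L y).det)⁻¹ * quadForm φ y * (L y)⁻¹ ^ 2 *
          ∑ k, (Lmetric L y).adjugate j k * pd L k y := by
    rw [Finset.mul_sum, Finset.mul_sum, ← Finset.sum_sub_distrib]
    exact Finset.sum_congr rfl fun k _ => by ring
  rw [h4, h3]
  field_simp

/-- Consequence (4.19) of the paper's Lemma 3: for a constant symmetric tensor `φ_{ij}`,
`(g^{ij}φ_{ij} − 4φ(y,y)/L)·det g/L²` is a total divergence. -/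
theorem quadratic_divergence_identity (U : Set (Fin 4 → ℝ)) (hUopen : IsOpen U)
    (hU0 : ∀ y ∈ U, y ≠ (0 : Fin 4 → ℝ))
    (hUconic : ∀ y ∈ U, ∀ l : ℝ, 0 < l → l • y ∈ U)
    (L : (Fin 4 → ℝ) → ℝ) (hLs : ContDiffOn ℝ (⊤ : ℕ∞) L U) (hL0 : ∀ y ∈ U, L y ≠ 0)
    (hhom : ∀ y ∈ U, ∀ l : ℝ, 0 < l → L (l • y) = l ^ 2 * L y)
    (hinv : ∀ y ∈ U, IsUnit (Lmetric L y).det)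
    (φ : Matrix (Fin 4) (Fin 4) ℝ) (hφ : φ.IsSymm) :
    ∀ y ∈ U,
      ((∑ i : Fin 4, ∑ j : Fin 4, (Lmetric L y)⁻¹ i j * φ i j) -
          4 * quadForm φ y / L y) * (Lmetric L y).det / (L y) ^ 2 =
        ∑ j : Fin 4,
          fderiv ℝ (fun z => bdryField L φ j z * (Lmetric L z).det / (L z) ^ 2) y
            (Pi.single j 1) := by
  intro y hy
  have hL := hL0 y hy
  have hdL := diffAt hUopen hLs hy
  have hG := g_diff hUopen hLs hy
  have hA := diff_adj (G := Lmetric L) hG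
  have hD := diff_det (G := Lmetric L) hG
  have hw := fun k => w_diff φ k y
  have hQ := quad_diff φ y
  have hi : DifferentiableAt ℝ (fun z => (L z)⁻¹) y := hdL.fun_inv hL
  have hc : ∀ j : Fin 4, DifferentiableAt ℝ (fun z : Fin 4 → ℝ => z j) y := fun j => by fun_prop
  have key : ∀ j, fderiv ℝ (fun z => bdryField L φ j z * (Lmetric L z).det / (L z) ^ 2) y
            (Pi.single j 1) =
      (∑ k, (pd (fun z => (Lmetric L z).adjugate j k) j y * wvec φ k y
          + (Lmetric L y).adjugate j k * φ k j)) * ((L y)⁻¹ * (L y)⁻¹)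
      + (∑ k, (Lmetric L y).adjugate j k * wvec φ k y) * (-2 * pd L j y * (L y)⁻¹ ^ 3)
      - ((2 * wvec φ j y * y j + quadForm φ y) * (Lmetric L y).det * (L y)⁻¹ ^ 3
        + quadForm φ y * y j * pd (fun z => (Lmetric L z).det) j y * (L y)⁻¹ ^ 3
        + quadForm φ y * y j * (Lmetric L y).det * (-3 * pd L j y * (L y)⁻¹ ^ 4)) := by
    intro j
    have hS := fun k => (hA j k).fun_mul (hw k)
    change pd _ j y = _
    rw [pd_congr hUopen (fun z hz => bdry_eq hUopen hLs hL0 hhom hinv hφ j hz) j hy]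
    rw [pd_sub ((DifferentiableAt.fun_sum (fun k _ => hS k)).fun_mul (hi.fun_mul hi))
      (((hQ.fun_mul (hc j)).fun_mul hD).fun_mul ((hi.fun_mul hi).fun_mul hi)),
      pd_mul (DifferentiableAt.fun_sum (fun k _ => hS k)) (hi.fun_mul hi),
      pd_mul ((hQ.fun_mul (hc j)).fun_mul hD) ((hi.fun_mul hi).fun_mul hi),
      pd_mul (hQ.fun_mul (hc j)) hD, pd_mul hQ (hc j), pd_mul (hi.fun_mul hi) hi, pd_mul hi hi,
      pd_sum hS, pd_inv hdL hL, pd_quad hφ, pd_coord]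
    simp_rw [fun k => pd_mul (hA j k) (hw k) j, pd_w]
    simp only [if_true]
    ring
  have hP : ∑ j, ∑ k, pd (fun z => (Lmetric L z).adjugate j k) j y * wvec φ k y = 0 := by
    rw [Finset.sum_comm]
    refine Finset.sum_eq_zero fun k _ => ?_
    rw [← Finset.sum_mul, piola hUopen hLs hy (hinv y hy), zero_mul]
  have hAL : ∑ j, (∑ k, (Lmetric L y).adjugate j k * wvec φ k y) * pd L j y
      = 2 * (Lmetric L y).det * quadForm φ y := by
    simp_rw [Finset.sum_mul]
    rw [Finset.sum_comm, quad_eq]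
    simp only [Finset.mul_sum]
    refine Finset.sum_congr rfl fun k _ => ?_
    have := adj_dL' hUopen hLs hhom hy k
    calc _ = (∑ j, (Lmetric L y).adjugate j k * pd L j y) * wvec φ k y := by
          rw [Finset.sum_mul]; exact Finset.sum_congr rfl fun _ _ => by ring
      _ = _ := by rw [this]; ring
  have hwy : ∑ j, wvec φ j y * y j = quadForm φ y := by
    rw [quad_eq]; exact Finset.sum_congr rfl fun _ _ => mul_comm _ _
  have hE := euler hUopen hLs hhom hy
  have hED := euler_det hUopen hLs hhom hy
  have hphi : (∑ i : Fin 4, ∑ j : Fin 4, (Lmetric L y)⁻¹ i j * φ i j) * (Lmetric L y).det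
      = ∑ j, ∑ k, (Lmetric L y).adjugate j k * φ k j := by
    have hD0 : (Lmetric L y).det ≠ 0 := (hinv y hy).ne_zero
    simp_rw [Finset.sum_mul]
    refine Finset.sum_congr rfl fun j _ => Finset.sum_congr rfl fun k _ => ?_
    rw [Matrix.inv_def, Ring.inverse_eq_inv', hφ.apply, Matrix.smul_apply, smul_eq_mul]
    field_simp
  simp_rw [key]
  have split : ∑ j, ((∑ k, (pd (fun z => (Lmetric L z).adjugate j k) j y * wvec φ k y
          + (Lmetric L y).adjugate j k * φ k j)) * ((L y)⁻¹ * (L y)⁻¹)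
      + (∑ k, (Lmetric L y).adjugate j k * wvec φ k y) * (-2 * pd L j y * (L y)⁻¹ ^ 3)
      - ((2 * wvec φ j y * y j + quadForm φ y) * (Lmetric L y).det * (L y)⁻¹ ^ 3
        + quadForm φ y * y j * pd (fun z => (Lmetric L z).det) j y * (L y)⁻¹ ^ 3
        + quadForm φ y * y j * (Lmetric L y).det * (-3 * pd L j y * (L y)⁻¹ ^ 4)))
      = (∑ j, ∑ k, pd (fun z => (Lmetric L z).adjugate j k) j y * wvec φ k y) * (L y)⁻¹ ^ 2
        + (∑ j, ∑ k, (Lmetric L y).adjugate j k * φ k j) * (L y)⁻¹ ^ 2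
        + (∑ j, (∑ k, (Lmetric L y).adjugate j k * wvec φ k y) * pd L j y) * (-2 * (L y)⁻¹ ^ 3)
        - ((2 * (∑ j, wvec φ j y * y j) + 4 * quadForm φ y) * (Lmetric L y).det * (L y)⁻¹ ^ 3
          + quadForm φ y * (∑ j, pd (fun z => (Lmetric L z).det) j y * y j) * (L y)⁻¹ ^ 3
          + quadForm φ y * (Lmetric L y).det * (∑ j, pd L j y * y j) * (-3 * (L y)⁻¹ ^ 4)) := by
    simp only [Finset.sum_add_distrib]
    generalize hS1 : (fun j => ∑ k, (Lmetric L y).adjugate j k * wvec φ k y) = S1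
    generalize hS2 : (fun j => ∑ k, pd (fun z => (Lmetric L z).adjugate j k) j y * wvec φ k y) = S2
    generalize hS3 : (fun j => ∑ k, (Lmetric L y).adjugate j k * φ k j) = S3
    have e1 := fun j => congrFun hS1 j
    have e2 := fun j => congrFun hS2 j
    have e3 := fun j => congrFun hS3 j
    simp only [e1, e2, e3, Fin.sum_univ_four]
    ring
  rw [split, hP, hAL, hwy, hE, hED, ← hphi]
  field_simp
  ring
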